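/- arXiv:2312.11305 — 9 statements merged into one kernel-verified Lean document; each statement's English description precedes it below -/
import Mathlib

section
/- Let a < b be real numbers, f : [a,b] → ℝ continuous, 0 < α < 1, and c_α = sin(πα)/π. Define φ(t,r) = c_α e^{(1-α)r} ∫_a^t e^{-(t-τ) e^r} f(τ) dτ. Then for every t ∈ [a,b], the Riemann–Liouville fractional integral satisfies I^α_a f(t) = ∫_{-∞}^{∞} φ(t,r) dr, i.e. (1/Γ(α)) ∫_a^t (t-τ)^{α-1} f(τ) dτ = ∫_{-∞}^{∞} φ(t,r) dr. -/
open MeasureTheory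

/-- The Gamma integral after the substitution `x = eʳ`. -/
lemma integral_exp_mul_exp_neg_mul_exp {β s : ℝ} (hβ : 0 < β) (hs : 0 < s) :
    ∫ r : ℝ, Real.exp (β * r) * Real.exp (-s * Real.exp r) = s ^ (-β) * Real.Gamma β := by
  have h := integral_image_eq_integral_abs_deriv_smul (s := Set.univ) (f := Real.exp)
    (f' := Real.exp) MeasurableSet.univ (fun x _ => (Real.hasDerivAt_exp x).hasDerivWithinAt)
    Real.exp_injective.injOn (fun x : ℝ => x ^ (β - 1) * Real.exp (-(s * x)))
  rw [Set.image_univ, Real.range_exp, Real.integral_rpow_mul_exp_neg_mul_Ioi hβ hs,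
    setIntegral_univ, one_div, Real.inv_rpow hs.le, ← Real.rpow_neg hs.le] at h
  rw [h]
  refine integral_congr_ae (.of_forall fun r => ?_)
  simp only [Real.abs_exp, smul_eq_mul]
  rw [← Real.exp_mul, ← Real.exp_add, ← Real.exp_add, ← Real.exp_add]
  congr 1
  ring

lemma integrable_exp_mul_exp_neg_mul_exp {β s : ℝ} (hβ : 0 < β) (hs : 0 < s) :
    Integrable fun r : ℝ => Real.exp (β * r) * Real.exp (-s * Real.exp r) := by
  refine .of_integral_ne_zero ?_
  rw [integral_exp_mul_exp_neg_mul_exp hβ hs]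
  exact (mul_pos (Real.rpow_pos_of_pos hs _) (Real.Gamma_pos_of_pos hβ)).ne'

lemma integrable_diffusive_kernel {a t α : ℝ} {f : ℝ → ℝ} (hat : a ≤ t)
    (hf : ContinuousOn f (Set.Icc a t)) (hα0 : 0 < α) (hα1 : α < 1) :
    Integrable (Function.uncurry fun τ r : ℝ =>
        Real.exp ((1 - α) * r) * Real.exp (-(t - τ) * Real.exp r) * f τ)
      ((volume.restrict (Set.Ioo a t)).prod volume) := by
  have hβ : 0 < 1 - α := sub_pos.2 hα1
  have hfm : AEStronglyMeasurable f (volume.restrict (Set.Ioo a t)) :=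
    (hf.mono Set.Ioo_subset_Icc_self).aestronglyMeasurable measurableSet_Ioo
  have hk : Continuous fun p : ℝ × ℝ =>
      Real.exp ((1 - α) * p.2) * Real.exp (-(t - p.1) * Real.exp p.2) := by fun_prop
  refine (integrable_prod_iff (hk.aestronglyMeasurable.mul hfm.comp_fst)).2 ?_
  constructor
  · refine (ae_restrict_iff' measurableSet_Ioo).2 (.of_forall fun τ hτ => ?_)
    exact (integrable_exp_mul_exp_neg_mul_exp hβ (sub_pos.2 hτ.2)).mul_const (f τ)
  · have hp : IntervalIntegrable (fun τ => (t - τ) ^ (α - 1)) volume a t := by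
      simpa using (intervalIntegral.intervalIntegrable_rpow' (a := t - a) (b := 0)
        (r := α - 1) (by linarith)).comp_sub_left t
    have hg : IntervalIntegrable (fun τ => (t - τ) ^ (α - 1) * (Real.Gamma (1 - α) * |f τ|))
        volume a t := by
      refine hp.mul_continuousOn ?_
      rw [Set.uIcc_of_le hat]
      exact continuousOn_const.mul hf.abs
    rw [intervalIntegrable_iff_integrableOn_Ioo_of_le hat] at hg
    refine hg.congr ((ae_restrict_iff' measurableSet_Ioo).2 (.of_forall fun τ hτ => ?_))
    simp only [Pi.mul_apply, norm_mul, Real.norm_eq_abs, Real.abs_exp]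
    rw [integral_mul_const, integral_exp_mul_exp_neg_mul_exp hβ (sub_pos.2 hτ.2), neg_sub]
    ring

/-- Diffusive representation of the Riemann–Liouville fractional integral with the
admissible transformation `ψ(r) = eʳ`:
`I^α_a f(t) = ∫_{-∞}^{∞} φ(t,r) dr` where
`φ(t,r) = c_α e^{(1-α)r} ∫_a^t e^{-(t-τ)eʳ} f(τ) dτ` and `c_α = sin(πα)/π`. -/
theorem diffusive_representation_exp (a b α : ℝ) (hab : a < b) (f : ℝ → ℝ)
    (hf : ContinuousOn f (Set.Icc a b)) (hα0 : 0 < α) (hα1 : α < 1)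
    (t : ℝ) (ht : t ∈ Set.Icc a b) :
    (1 / Real.Gamma α) * ∫ τ in a..t, (t - τ) ^ (α - 1) * f τ
      = ∫ r : ℝ, (Real.sin (Real.pi * α) / Real.pi) * Real.exp ((1 - α) * r) *
          ∫ τ in a..t, Real.exp (-(t - τ) * Real.exp r) * f τ := by
  have hβ : 0 < 1 - α := sub_pos.2 hα1
  have hΓ : 1 / Real.Gamma α
      = Real.sin (Real.pi * α) / Real.pi * Real.Gamma (1 - α) := by
    have h := Real.Gamma_mul_Gamma_one_sub α
    have hsin : 0 < Real.sin (Real.pi * α) :=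
      Real.sin_pos_of_pos_of_lt_pi (by positivity) (by nlinarith [Real.pi_pos])
    have hg := Real.Gamma_pos_of_pos hα0
    have hpi := Real.pi_pos
    rw [eq_div_iff hsin.ne'] at h
    rw [div_eq_iff hg.ne', div_mul_eq_mul_div, div_mul_eq_mul_div, eq_div_iff hpi.ne']
    linarith
  have hswap := integral_integral_swap (integrable_diffusive_kernel ht.1
    (hf.mono (Set.Icc_subset_Icc_right ht.2)) hα0 hα1)
  simp only [intervalIntegral.integral_of_le ht.1, integral_Ioc_eq_integral_Ioo]
  calc _ = Real.sin (Real.pi * α) / Real.pi * ∫ τ in Set.Ioo a t, ∫ r : ℝ,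
          Real.exp ((1 - α) * r) * Real.exp (-(t - τ) * Real.exp r) * f τ := by
        rw [hΓ, mul_assoc, ← integral_const_mul (Real.Gamma (1 - α))]
        congr 1
        refine setIntegral_congr_fun measurableSet_Ioo fun τ hτ => ?_
        rw [integral_mul_const, integral_exp_mul_exp_neg_mul_exp hβ (sub_pos.2 hτ.2), neg_sub]
        ring
    _ = _ := by
        rw [hswap, ← integral_const_mul]
        simp only [mul_assoc, integral_const_mul]
end

section
/- Let a < b be real numbers, f : [a,b] → ℝ continuous, 0 < α < 1, and c_α = sin(πα)/π. For every fixed t ∈ [a,b], the function r ↦ φ(t,r) = c_α e^{(1-α)r} ∫_a^t e^{-(t-τ) e^r} f(τ) dτ is infinitely differentiable on ℝ. -/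
open MeasureTheory

/-- `φ(t,r) = c_α e^{(1-α)r} ∫_a^t e^{-(t-τ)eʳ} f(τ) dτ` with `c_α = sin(πα)/π`. -/
noncomputable def phi (a α r : ℝ) (f : ℝ → ℝ) (t : ℝ) : ℝ :=
  (Real.sin (Real.pi * α) / Real.pi) * Real.exp ((1 - α) * r) *
    ∫ τ in a..t, Real.exp (-(t - τ) * Real.exp r) * f τ

theorem hasDerivAt_integral_exp_mul {a t : ℝ} {u g : ℝ → ℝ} (hu : Continuous u)
    (hg : IntervalIntegrable g volume a t) (s : ℝ) :
    HasDerivAt (fun s : ℝ => ∫ τ in a..t, Real.exp (u τ * s) * g τ)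
      (∫ τ in a..t, Real.exp (u τ * s) * (u τ * g τ)) s := by
  have hint (s : ℝ) : IntervalIntegrable (fun τ => Real.exp (u τ * s) * g τ) volume a t :=
    hg.continuousOn_mul (by fun_prop)
  have hint' (s : ℝ) :
      IntervalIntegrable (fun τ => Real.exp (u τ * s) * (u τ * g τ)) volume a t :=
    (hg.continuousOn_mul hu.continuousOn).continuousOn_mul (by fun_prop)
  refine (intervalIntegral.hasDerivAt_integral_of_dominated_loc_of_deriv_le
    (F' := fun s τ => Real.exp (u τ * s) * (u τ * g τ))
    (bound := fun τ => Real.exp (|u τ| * (|s| + 1)) * (|u τ| * |g τ|))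
    (Metric.ball_mem_nhds s one_pos) (.of_forall fun s => (hint s).def'.aestronglyMeasurable)
    (hint s) (hint' s).def'.aestronglyMeasurable ?_ ?_ ?_).2
  · refine .of_forall fun τ _ x hx => ?_
    rw [Real.norm_eq_abs, abs_mul, abs_mul, Real.abs_exp]
    have hx' : |x| ≤ |s| + 1 := by
      rw [Metric.mem_ball, Real.dist_eq] at hx
      have := abs_sub_abs_le_abs_sub x s
      linarith
    refine mul_le_mul_of_nonneg_right (Real.exp_le_exp.2 ?_) (by positivity)
    calc u τ * x ≤ |u τ * x| := le_abs_self _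
      _ = |u τ| * |x| := abs_mul _ _
      _ ≤ |u τ| * (|s| + 1) := by gcongr
  · exact (hg.abs.continuousOn_mul hu.abs.continuousOn).continuousOn_mul (by fun_prop)
  · refine .of_forall fun τ _ x _ => ?_
    have h := (((hasDerivAt_id x).const_mul (u τ)).exp).mul_const (g τ)
    simpa [mul_assoc] using h

theorem contDiff_integral_exp_mul {a t : ℝ} {u g : ℝ → ℝ} (hu : Continuous u)
    (hg : IntervalIntegrable g volume a t) :
    ContDiff ℝ (⊤ : ℕ∞) (fun s : ℝ => ∫ τ in a..t, Real.exp (u τ * s) * g τ) := by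
  refine contDiff_infty.2 fun n => ?_
  induction n generalizing g with
  | zero =>
    exact contDiff_zero.2 <| continuous_iff_continuousAt.2 fun s =>
      (hasDerivAt_integral_exp_mul hu hg s).continuousAt
  | succ n ih =>
    push_cast
    refine contDiff_succ_iff_deriv.2
      ⟨fun s => (hasDerivAt_integral_exp_mul hu hg s).differentiableAt, by simp, ?_⟩
    rw [funext fun s => (hasDerivAt_integral_exp_mul hu hg s).deriv]
    exact ih (hg.continuousOn_mul hu.continuousOn)

/-- For every fixed `t ∈ [a,b]`, the function `r ↦ φ(t,r)` is infinitely
differentiable on `ℝ`. -/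
theorem phi_smooth_in_r (a b α : ℝ) (hab : a < b) (f : ℝ → ℝ)
    (hf : ContinuousOn f (Set.Icc a b)) (hα0 : 0 < α) (hα1 : α < 1)
    (t : ℝ) (ht : t ∈ Set.Icc a b) :
    ContDiff ℝ (⊤ : ℕ∞) (fun r : ℝ => phi a α r f t) := by
  have hg : IntervalIntegrable f volume a t :=
    (hf.mono (Set.Icc_subset_Icc_right ht.2)).intervalIntegrable_of_Icc ht.1
  have h := (contDiff_integral_exp_mul (u := fun τ => -(t - τ)) (by fun_prop) hg).comp
    Real.contDiff_exp
  exact ContDiff.mul (by fun_prop) h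
end

section
/- Let a < b be real numbers, f : [a,b] → ℝ continuous, 0 < α < 1, and c_α = sin(πα)/π. For every fixed t ∈ [a,b] there exists a constant C ≥ 0 such that |φ(t,r)| ≤ C e^{-α r} for all r ∈ ℝ, where φ(t,r) = c_α e^{(1-α)r} ∫_a^t e^{-(t-τ) e^r} f(τ) dτ. In particular one may take C = c_α · sup_{τ∈[a,b]} |f(τ)|. -/
open MeasureTheory

/-- The exponential kernel on `[a, t]` has mass at most `1 / k`, so integrating it against a
function bounded by `M` gives at most `M / k`. -/
lemma abs_integral_exp_kernel_mul_le {a t k M : ℝ} (hat : a ≤ t) (hk : 0 < k) (hM : 0 ≤ M)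
    {f : ℝ → ℝ} (hf : ∀ τ ∈ Set.Icc a t, |f τ| ≤ M) :
    |∫ τ in a..t, Real.exp (-(t - τ) * k) * f τ| ≤ M / k := by
  have hderiv : ∀ τ ∈ Set.uIcc a t,
      HasDerivAt (fun τ => Real.exp (-(t - τ) * k) * (M / k))
        (Real.exp (-(t - τ) * k) * M) τ := by
    intro τ _
    have h : HasDerivAt (fun τ : ℝ => -(t - τ) * k) k τ := by
      simpa using (((hasDerivAt_id τ).const_sub t).neg.mul_const k)
    refine (h.exp.mul_const (M / k)).congr_deriv ?_
    rw [mul_assoc, mul_div_cancel₀ M hk.ne']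
  have hint : IntervalIntegrable (fun τ => Real.exp (-(t - τ) * k) * M) volume a t :=
    Continuous.intervalIntegrable (by fun_prop) a t
  have hbound : ‖∫ τ in a..t, Real.exp (-(t - τ) * k) * f τ‖ ≤
      ∫ τ in a..t, Real.exp (-(t - τ) * k) * M := by
    refine intervalIntegral.norm_integral_le_of_norm_le hat (ae_of_all _ fun τ hτ => ?_) hint
    rw [norm_mul, Real.norm_eq_abs, Real.abs_exp, Real.norm_eq_abs]
    exact mul_le_mul_of_nonneg_left (hf τ ⟨hτ.1.le, hτ.2⟩) (Real.exp_pos _).le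
  rw [intervalIntegral.integral_eq_sub_of_hasDerivAt hderiv hint] at hbound
  have hpos : 0 ≤ Real.exp (-(t - a) * k) * (M / k) := by positivity
  simp only [sub_self, neg_zero, zero_mul, Real.exp_zero, one_mul, Real.norm_eq_abs] at hbound
  linarith

/-- For every fixed `t ∈ [a,b]` there is a constant `C ≥ 0` with
`|φ(t,r)| ≤ C e^{-α r}` for all `r ∈ ℝ`; in particular one may take
`C = c_α · sup_{τ ∈ [a,b]} |f(τ)|`. -/
theorem phi_decay_at_top (a b α : ℝ) (hab : a < b) (f : ℝ → ℝ)
    (hf : ContinuousOn f (Set.Icc a b)) (hα0 : 0 < α) (hα1 : α < 1)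
    (t : ℝ) (ht : t ∈ Set.Icc a b) :
    (∃ C : ℝ, 0 ≤ C ∧ ∀ r : ℝ, |phi a α r f t| ≤ C * Real.exp (-α * r)) ∧
    (∀ r : ℝ, |phi a α r f t| ≤
      (Real.sin (Real.pi * α) / Real.pi) * sSup ((fun τ => |f τ|) '' Set.Icc a b) *
        Real.exp (-α * r)) := by
  have hc : 0 ≤ Real.sin (Real.pi * α) / Real.pi :=
    div_nonneg (Real.sin_nonneg_of_nonneg_of_le_pi (by positivity)
      (by nlinarith [Real.pi_pos])) Real.pi_pos.le
  set M := sSup ((fun τ => |f τ|) '' Set.Icc a b)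
  have hfM : ∀ τ ∈ Set.Icc a b, |f τ| ≤ M := fun τ hτ =>
    le_csSup (isCompact_Icc.image_of_continuousOn hf.abs).bddAbove (Set.mem_image_of_mem _ hτ)
  have hM : 0 ≤ M := (abs_nonneg _).trans (hfM t ht)
  have hphi : ∀ r : ℝ, |phi a α r f t| ≤
      (Real.sin (Real.pi * α) / Real.pi) * M * Real.exp (-α * r) := by
    intro r
    have hI := abs_integral_exp_kernel_mul_le ht.1 (Real.exp_pos r) hM
      fun τ hτ => hfM τ ⟨hτ.1, hτ.2.trans ht.2⟩
    have hexp : Real.exp ((1 - α) * r) = Real.exp (-α * r) * Real.exp r := by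
      rw [← Real.exp_add]
      ring_nf
    rw [phi, abs_mul, abs_mul, abs_of_nonneg hc, Real.abs_exp]
    refine (mul_le_mul_of_nonneg_left hI (by positivity)).trans_eq ?_
    rw [hexp]
    field_simp
  exact ⟨⟨_, mul_nonneg hc hM, hphi⟩, hphi⟩
end

section
/- Let a < b be real numbers, f : [a,b] → ℝ continuous, 0 < α < 1, c_α = sin(πα)/π, and 0 < h < b - a. Let Ω be a nonempty open interval and ψ : Ω → (0,∞) a strictly increasing C¹ function with ψ(r) → 0 as r → inf Ω and ψ(r) → +∞ as r → sup Ω. Define μ(t,h,r) = c_α ψ'(r) (ψ(r))^{-α} ∫_a^{t-h} e^{-(t-τ) ψ(r)} f(τ) dτ. Then for every t ∈ [a+h, b], the history part of the Riemann–Liouville integral satisfies H^α_{a,h} f(t) = ∫_Ω μ(t,h,r) dr, i.e. (1/Γ(α)) ∫_a^{t-h} (t-τ)^{α-1} f(τ) dτ = ∫_Ω μ(t,h,r) dr. -/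
open MeasureTheory

/-- `μ(t,h,r) = c_α ψ'(r) ψ(r)^{-α} ∫_a^{t-h} e^{-(t-τ)ψ(r)} f(τ) dτ`, `c_α = sin(πα)/π`. -/
noncomputable def muPsi (a α h : ℝ) (ψ ψ' : ℝ → ℝ) (f : ℝ → ℝ) (t r : ℝ) : ℝ :=
  (Real.sin (Real.pi * α) / Real.pi) * ψ' r * (ψ r) ^ (-α) *
    ∫ τ in a..(t - h), Real.exp (-(t - τ) * ψ r) * f τ

open Set

/-- A positive continuous function on an interval whose values tend to `0` at the left
end and to `∞` at the right end maps the interval onto the positive half-line. -/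
lemma image_eq_Ioi_zero_of_tendsto {Ω : Set ℝ} (hΩne : Ω.Nonempty) (hΩconn : Ω.OrdConnected)
    {ψ : ℝ → ℝ} (hψpos : ∀ r ∈ Ω, 0 < ψ r) (hψcont : ContinuousOn ψ Ω)
    (hψ0 : Filter.Tendsto (fun x : Ω => ψ x) Filter.atBot (nhds 0))
    (hψtop : Filter.Tendsto (fun x : Ω => ψ x) Filter.atTop Filter.atTop) :
    ψ '' Ω = Ioi 0 := by
  have : Nonempty Ω := hΩne.to_subtype
  refine Subset.antisymm (image_subset_iff.2 hψpos) fun y (hy : 0 < y) => ?_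
  obtain ⟨r₁, h₁⟩ := (hψ0.eventually (gt_mem_nhds hy)).exists
  obtain ⟨r₂, h₂⟩ := (hψtop.eventually_gt_atTop y).exists
  exact (hΩconn.isPreconnected.image ψ hψcont).ordConnected.out
    (mem_image_of_mem ψ r₁.2) (mem_image_of_mem ψ r₂.2) ⟨h₁.le, h₂.le⟩

lemma integrableOn_rpow_neg_mul_exp_neg_mul {α c : ℝ} (hα : α < 1) (hc : 0 < c) :
    IntegrableOn (fun s : ℝ => s ^ (-α) * Real.exp (-c * s)) (Ioi 0) := by
  simpa using integrableOn_rpow_mul_exp_neg_mul_rpow (s := -α) (p := 1) (by linarith) one_pos hc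

lemma integral_rpow_neg_mul_exp_neg_mul {α c : ℝ} (hα : α < 1) (hc : 0 < c) :
    ∫ s in Ioi (0 : ℝ), s ^ (-α) * Real.exp (-c * s) = c ^ (α - 1) * Real.Gamma (1 - α) := by
  have h := Real.integral_rpow_mul_exp_neg_mul_Ioi (a := 1 - α) (by linarith) hc
  rw [one_div, Real.inv_rpow hc.le, ← Real.rpow_neg hc.le, neg_sub] at h
  rw [← h]
  refine setIntegral_congr_fun measurableSet_Ioi fun s _ => ?_
  simp [sub_sub_cancel_left, neg_mul]

/-- The integrand of the diffusive representation is integrable when the history stays at a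
distance at least `h > 0` from `t`. -/
lemma integrable_rpow_neg_mul_exp_mul_prod {α h t : ℝ} (hα : α < 1) (hh : 0 < h) {S : Set ℝ}
    (hS : MeasurableSet S) (hSt : ∀ τ ∈ S, h ≤ t - τ) {f : ℝ → ℝ} (hf : IntegrableOn f S) :
    Integrable (fun p : ℝ × ℝ => p.1 ^ (-α) * (Real.exp (-(t - p.2) * p.1) * f p.2))
      ((volume.restrict (Ioi 0)).prod (volume.restrict S)) := by
  refine ((integrableOn_rpow_neg_mul_exp_neg_mul hα hh).integrable.mul_prod hf).mono ?_ ?_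
  · refine AEStronglyMeasurable.mul ?_ (AEStronglyMeasurable.mul ?_ ?_)
    · exact (measurable_fst.pow_const _).aestronglyMeasurable
    · exact (by fun_prop : Continuous fun p : ℝ × ℝ =>
        Real.exp (-(t - p.2) * p.1)).aestronglyMeasurable
    · exact hf.aestronglyMeasurable.comp_snd
  · rw [Measure.prod_restrict]
    filter_upwards [ae_restrict_mem (measurableSet_Ioi.prod hS)] with p hp
    have hp1 : 0 < p.1 := hp.1
    have hp2 := hSt p.2 hp.2
    rw [norm_mul, norm_mul, norm_mul, norm_mul, mul_assoc]
    gcongr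
    rw [Real.norm_of_nonneg (Real.exp_nonneg _), Real.norm_of_nonneg (Real.exp_nonneg _)]
    gcongr

/-- Diffusive representation of the history part of the Riemann–Liouville integral:
for every `t ∈ [a+h, b]`, `H^α_{a,h} f(t) = ∫_Ω μ(t,h,r) dr`. -/
theorem history_diffusive_representation (a b α h : ℝ) (hab : a < b) (f : ℝ → ℝ)
    (hf : ContinuousOn f (Set.Icc a b)) (hα0 : 0 < α) (hα1 : α < 1)
    (hh0 : 0 < h) (hhb : h < b - a)
    (Ω : Set ℝ) (hΩne : Ω.Nonempty) (hΩopen : IsOpen Ω) (hΩconn : Ω.OrdConnected)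
    (ψ ψ' : ℝ → ℝ) (hψpos : ∀ r ∈ Ω, 0 < ψ r) (hψmono : StrictMonoOn ψ Ω)
    (hψderiv : ∀ r ∈ Ω, HasDerivAt ψ (ψ' r) r) (hψ'cont : ContinuousOn ψ' Ω)
    (hψ0 : Filter.Tendsto (fun x : Ω => ψ x) Filter.atBot (nhds 0))
    (hψtop : Filter.Tendsto (fun x : Ω => ψ x) Filter.atTop Filter.atTop)
    (t : ℝ) (ht : t ∈ Set.Icc (a + h) b) :
    (1 / Real.Gamma α) * ∫ τ in a..(t - h), (t - τ) ^ (α - 1) * f τ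
      = ∫ r in Ω, muPsi a α h ψ ψ' f t r := by
  have hSt : ∀ τ ∈ Ioc a (t - h), h ≤ t - τ := fun τ hτ => by linarith [hτ.2]
  have hle : a ≤ t - h := by linarith [ht.1]
  have hfS : IntegrableOn f (Ioc a (t - h)) :=
    ((hf.mono (Icc_subset_Icc_right (by linarith [ht.2]))).integrableOn_Icc).mono_set
      Ioc_subset_Icc_self
  set C := Real.sin (Real.pi * α) / Real.pi with hC
  have hψcont : ContinuousOn ψ Ω := fun r hr => (hψderiv r hr).continuousAt.continuousWithinAt
  have hcov := integral_image_eq_integral_deriv_smul_of_monotoneOn hΩopen.measurableSet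
    (fun r hr => (hψderiv r hr).hasDerivWithinAt) hψmono.monotoneOn
    (fun s => C * ∫ τ in Ioc a (t - h), s ^ (-α) * (Real.exp (-(t - τ) * s) * f τ))
  rw [image_eq_Ioi_zero_of_tendsto hΩne hΩconn hψpos hψcont hψ0 hψtop] at hcov
  have hmu : ∀ r, muPsi a α h ψ ψ' f t r = ψ' r • (C * ∫ τ in Ioc a (t - h),
      ψ r ^ (-α) * (Real.exp (-(t - τ) * ψ r) * f τ)) := fun r => by
    rw [muPsi, intervalIntegral.integral_of_le hle, integral_const_mul, smul_eq_mul]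
    ring
  simp_rw [hmu]
  rw [← hcov, integral_const_mul, integral_integral_swap
    (integrable_rpow_neg_mul_exp_mul_prod hα1 hh0 measurableSet_Ioc hSt hfS),
    intervalIntegral.integral_of_le hle]
  have hinner : ∀ τ ∈ Ioc a (t - h),
      ∫ s in Ioi (0 : ℝ), s ^ (-α) * (Real.exp (-(t - τ) * s) * f τ)
        = Real.Gamma (1 - α) * ((t - τ) ^ (α - 1) * f τ) := fun τ hτ => by
    simp_rw [← mul_assoc]
    rw [integral_mul_const,
      integral_rpow_neg_mul_exp_neg_mul hα1 (hh0.trans_le (hSt τ hτ))]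
    ring
  rw [setIntegral_congr_fun measurableSet_Ioc hinner, integral_const_mul, ← mul_assoc]
  congr 1
  have hΓ := Real.Gamma_mul_Gamma_one_sub α
  have hΓα := (Real.Gamma_pos_of_pos hα0).ne'
  have hsin : Real.sin (Real.pi * α) ≠ 0 := (Real.sin_pos_of_pos_of_lt_pi
    (by positivity) (by nlinarith [Real.pi_pos])).ne'
  rw [hC, eq_div_of_mul_eq hΓα ((mul_comm _ _).trans hΓ)]
  field_simp
end

section
/- Let a < b be real numbers, f : [a,b] → ℝ continuous, 0 < α < 1, c_α = sin(πα)/π, and 0 < h < b - a. Let Ω be a nonempty open interval and ψ : Ω → (0,∞) a strictly increasing C¹ function with ψ(r) → 0 as r → inf Ω and ψ(r) → +∞ as r → sup Ω. For fixed r ∈ Ω, the function t ↦ μ(t,h,r) = c_α ψ'(r) (ψ(r))^{-α} ∫_a^{t-h} e^{-(t-τ) ψ(r)} f(τ) dτ is the unique solution on [a+h, b] of the initial value problem ∂μ/∂t (t,h,r) = -ψ(r) μ(t,h,r) + c_α ψ'(r) (ψ(r))^{-α} e^{-h ψ(r)} f(t-h) with μ(a+h, h, r) = 0. -/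
open MeasureTheory

/-- Two solutions of the linear equation `y' = -p y + q t` on `[c, d]` which agree at `c`
agree on `[c, d]`. -/
theorem eqOn_Icc_of_hasDerivWithinAt_linear {c d p : ℝ} {q u v : ℝ → ℝ}
    (hu : ∀ t ∈ Set.Icc c d, HasDerivWithinAt u (-p * u t + q t) (Set.Icc c d) t)
    (hv : ∀ t ∈ Set.Icc c d, HasDerivWithinAt v (-p * v t + q t) (Set.Icc c d) t)
    (huv : u c = v c) : Set.EqOn u v (Set.Icc c d) := by
  intro t ht
  have hderiv : ∀ s ∈ Set.Icc c d,
      HasDerivWithinAt (fun s => Real.exp (p * s) * (u s - v s)) 0 (Set.Icc c d) s := by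
    intro s hs
    have hexp : HasDerivWithinAt (fun s => Real.exp (p * s)) (Real.exp (p * s) * (p * 1))
        (Set.Icc c d) s := ((hasDerivWithinAt_id s _).const_mul p).exp
    exact (hexp.mul ((hu s hs).sub (hv s hs))).congr_deriv (by simp only [Pi.sub_apply]; ring)
  have hconst := constant_of_has_deriv_right_zero
    (fun s hs => (hderiv s hs).continuousWithinAt)
    (fun s hs => (hderiv s (Set.Ico_subset_Icc_self hs)).mono_of_mem_nhdsWithin
      (Icc_mem_nhdsGE_of_mem hs)) t ht
  simpa [huv, Real.exp_ne_zero, sub_eq_zero] using hconst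

/-- The delayed convolution of a continuous function with an exponential solves a linear
differential equation. -/
theorem hasDerivAt_integral_exp_mul_delay {F : ℝ → ℝ} (hF : Continuous F) (a h p t : ℝ) :
    HasDerivAt (fun t => ∫ τ in a..(t - h), Real.exp (-(t - τ) * p) * F τ)
      (-p * (∫ τ in a..(t - h), Real.exp (-(t - τ) * p) * F τ) + Real.exp (-h * p) * F (t - h))
      t := by
  have hfactor : ∀ t, ∫ τ in a..(t - h), Real.exp (-(t - τ) * p) * F τ =
      Real.exp (-p * t) * ∫ τ in a..(t - h), Real.exp (p * τ) * F τ := by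
    intro t
    rw [← intervalIntegral.integral_const_mul]
    refine intervalIntegral.integral_congr fun τ _ => ?_
    simp only [← mul_assoc, ← Real.exp_add]
    ring_nf
  simp only [hfactor]
  have hcont : Continuous fun τ => Real.exp (p * τ) * F τ := by fun_prop
  have hint : HasDerivAt (fun t => ∫ τ in a..(t - h), Real.exp (p * τ) * F τ)
      (Real.exp (p * (t - h)) * F (t - h)) t :=
    (hcont.integral_hasStrictDerivAt a (t - h)).hasDerivAt.comp_sub_const t h
  have hexp : HasDerivAt (fun t => Real.exp (-p * t)) (Real.exp (-p * t) * (-p * 1)) t :=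
    ((hasDerivAt_id t).const_mul (-p)).exp
  refine (hexp.mul hint).congr_deriv ?_
  have hadd : Real.exp (-h * p) = Real.exp (-p * t) * Real.exp (p * (t - h)) := by
    rw [← Real.exp_add]
    ring_nf
  rw [hadd]
  ring

/-- For fixed `r ∈ Ω`, the function `t ↦ μ(t,h,r)` is the unique solution on `[a+h, b]`
of `∂μ/∂t (t,h,r) = -ψ(r) μ(t,h,r) + c_α ψ'(r) ψ(r)^{-α} e^{-hψ(r)} f(t-h)`
with `μ(a+h,h,r) = 0`. -/
theorem muPsi_unique_solution_ivp (a b α h : ℝ) (hab : a < b) (f : ℝ → ℝ)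
    (hf : ContinuousOn f (Set.Icc a b)) (hα0 : 0 < α) (hα1 : α < 1)
    (hh0 : 0 < h) (hhb : h < b - a)
    (Ω : Set ℝ) (hΩne : Ω.Nonempty) (hΩopen : IsOpen Ω) (hΩconn : Ω.OrdConnected)
    (ψ ψ' : ℝ → ℝ) (hψpos : ∀ r ∈ Ω, 0 < ψ r) (hψmono : StrictMonoOn ψ Ω)
    (hψderiv : ∀ r ∈ Ω, HasDerivAt ψ (ψ' r) r) (hψ'cont : ContinuousOn ψ' Ω)
    (hψ0 : Filter.Tendsto (fun x : Ω => ψ x) Filter.atBot (nhds 0))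
    (hψtop : Filter.Tendsto (fun x : Ω => ψ x) Filter.atTop Filter.atTop)
    (r : ℝ) (hr : r ∈ Ω) :
    muPsi a α h ψ ψ' f (a + h) r = 0 ∧
    (∀ t ∈ Set.Icc (a + h) b,
      HasDerivWithinAt (fun t => muPsi a α h ψ ψ' f t r)
        (-ψ r * muPsi a α h ψ ψ' f t r +
          (Real.sin (Real.pi * α) / Real.pi) * ψ' r * (ψ r) ^ (-α) *
            Real.exp (-h * ψ r) * f (t - h))
        (Set.Icc (a + h) b) t) ∧
    (∀ g : ℝ → ℝ, g (a + h) = 0 →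
      (∀ t ∈ Set.Icc (a + h) b,
        HasDerivWithinAt g
          (-ψ r * g t +
            (Real.sin (Real.pi * α) / Real.pi) * ψ' r * (ψ r) ^ (-α) *
              Real.exp (-h * ψ r) * f (t - h))
          (Set.Icc (a + h) b) t) →
      ∀ t ∈ Set.Icc (a + h) b, g t = muPsi a α h ψ ψ' f t r) := by
  have hleft : muPsi a α h ψ ψ' f (a + h) r = 0 := by simp [muPsi]
  have hsol : ∀ t ∈ Set.Icc (a + h) b,
      HasDerivWithinAt (fun t => muPsi a α h ψ ψ' f t r)
        (-ψ r * muPsi a α h ψ ψ' f t r +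
          (Real.sin (Real.pi * α) / Real.pi) * ψ' r * (ψ r) ^ (-α) *
            Real.exp (-h * ψ r) * f (t - h))
        (Set.Icc (a + h) b) t := by
    set F : ℝ → ℝ := Set.IccExtend hab.le ((Set.Icc a b).domRestrict f)
    have hF : Continuous F := hf.domRestrict.Icc_extend'
    have hFf : ∀ s ∈ Set.Icc a b, F s = f s := fun s hs => Set.IccExtend_of_mem _ _ hs
    have hmu : ∀ t ∈ Set.Icc (a + h) b,
        muPsi a α h ψ ψ' f t r = muPsi a α h ψ ψ' F t r := by
      intro t ht
      unfold muPsi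
      congr 1
      refine intervalIntegral.integral_congr fun τ hτ => ?_
      rw [Set.uIcc_of_le (by linarith [ht.1])] at hτ
      simp only [hFf τ ⟨hτ.1, by linarith [hτ.2, ht.2]⟩]
    intro t ht
    rw [hmu t ht, ← hFf (t - h) ⟨by linarith [ht.1], by linarith [ht.2]⟩]
    refine HasDerivWithinAt.congr ?_ hmu (hmu t ht)
    refine (((hasDerivAt_integral_exp_mul_delay hF a h (ψ r) t).const_mul
      ((Real.sin (Real.pi * α) / Real.pi) * ψ' r * (ψ r) ^ (-α))).congr_deriv
        ?_).hasDerivWithinAt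
    unfold muPsi
    ring
  exact ⟨hleft, hsol, fun g hg hgderiv =>
    eqOn_Icc_of_hasDerivWithinAt_linear hgderiv hsol (hg.trans hleft.symm)⟩
end

section
/- Let a < b be real numbers, f : [a,b] → ℝ continuous, 0 < α < 1, c_α = sin(πα)/π, and 0 < h < b - a. Let Ω be a nonempty open interval and ψ : Ω → (0,∞) a strictly increasing admissible transformation that is moreover k times continuously differentiable on Ω for some k ∈ ℕ, k ≥ 1. Then for every fixed t ∈ [a+h, b], the function r ↦ μ(t,h,r) = c_α ψ'(r) (ψ(r))^{-α} ∫_a^{t-h} e^{-(t-τ) ψ(r)} f(τ) dτ is (k-1) times continuously differentiable on Ω. -/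
open MeasureTheory

/-- The derivative of a weighted exponential integral over a bounded interval. -/
theorem hasDerivAt_intervalIntegral_exp_mul (c d t : ℝ) (f : ℝ → ℝ)
    (hf : ContinuousOn f (Set.uIcc c d)) (s : ℝ) :
    HasDerivAt (fun s => ∫ τ in c..d, Real.exp (-(t - τ) * s) * f τ)
      (∫ τ in c..d, Real.exp (-(t - τ) * s) * (-(t - τ) * f τ)) s := by
  have hcont (g : ℝ → ℝ) (hg : ContinuousOn g (Set.uIcc c d)) (x : ℝ) :
      ContinuousOn (fun τ => Real.exp (-(t - τ) * x) * g τ) (Set.uIcc c d) :=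
    ContinuousOn.mul (by fun_prop) hg
  have hf' : ContinuousOn (fun τ => -(t - τ) * f τ) (Set.uIcc c d) :=
    ContinuousOn.mul (by fun_prop) hf
  refine (intervalIntegral.hasDerivAt_integral_of_dominated_loc_of_deriv_le
    (F := fun s τ => Real.exp (-(t - τ) * s) * f τ)
    (F' := fun s τ => Real.exp (-(t - τ) * s) * (-(t - τ) * f τ))
    (bound := fun τ => Real.exp (|t - τ| * (|s| + 1)) * |-(t - τ) * f τ|)
    (Metric.ball_mem_nhds s one_pos) (.of_forall fun x => ?_)
    (hcont f hf s).intervalIntegrable ?_ (.of_forall fun τ _ x hx => ?_) ?_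
    (.of_forall fun τ _ x _ => ?_)).2
  · exact (IntervalIntegrable.def' (hcont f hf x).intervalIntegrable).aestronglyMeasurable
  · exact (IntervalIntegrable.def' (hcont _ hf' s).intervalIntegrable).aestronglyMeasurable
  · rw [norm_mul, Real.norm_eq_abs, Real.norm_eq_abs, Real.abs_exp]
    have hx' : |x| ≤ |s| + 1 := by
      rw [Metric.mem_ball, Real.dist_eq] at hx
      linarith [abs_sub_abs_le_abs_sub x s]
    refine mul_le_mul_of_nonneg_right (Real.exp_le_exp.2 ?_) (abs_nonneg _)
    calc -(t - τ) * x ≤ |-(t - τ) * x| := le_abs_self _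
      _ = |t - τ| * |x| := by rw [abs_mul, abs_neg]
      _ ≤ |t - τ| * (|s| + 1) := by gcongr
  · exact (ContinuousOn.mul (by fun_prop) hf'.abs).intervalIntegrable
  · exact (((hasDerivAt_id' x).const_mul (-(t - τ))).exp.mul_const (f τ)).congr_deriv (by ring)

/-- A weighted exponential integral over a bounded interval depends smoothly on its exponent. -/
theorem contDiff_intervalIntegral_exp_mul (n : ℕ) (c d t : ℝ) (f : ℝ → ℝ)
    (hf : ContinuousOn f (Set.uIcc c d)) :
    ContDiff ℝ n (fun s => ∫ τ in c..d, Real.exp (-(t - τ) * s) * f τ) := by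
  have hderiv := hasDerivAt_intervalIntegral_exp_mul c d t
  induction n generalizing f with
  | zero =>
    exact contDiff_zero.2 (continuous_iff_continuousAt.2 fun s => (hderiv f hf s).continuousAt)
  | succ n ih =>
    rw [Nat.cast_succ, contDiff_succ_iff_deriv]
    refine ⟨fun s => (hderiv f hf s).differentiableAt, by simp, ?_⟩
    rw [funext fun s => (hderiv f hf s).deriv]
    exact ih _ (ContinuousOn.mul (by fun_prop) hf)

/-- If the admissible transformation `ψ` is `k` times continuously differentiable on `Ω`
(`k ≥ 1`), then for any fixed `t ∈ [a+h, b]`, `μ(t,h,·)` is `(k-1)` times continuously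
differentiable on `Ω`. -/
theorem muPsi_contDiff_in_r (a b α h : ℝ) (hab : a < b) (f : ℝ → ℝ)
    (hf : ContinuousOn f (Set.Icc a b)) (hα0 : 0 < α) (hα1 : α < 1)
    (hh0 : 0 < h) (hhb : h < b - a)
    (Ω : Set ℝ) (hΩne : Ω.Nonempty) (hΩopen : IsOpen Ω) (hΩconn : Ω.OrdConnected)
    (ψ ψ' : ℝ → ℝ) (hψpos : ∀ r ∈ Ω, 0 < ψ r) (hψmono : StrictMonoOn ψ Ω)
    (hψderiv : ∀ r ∈ Ω, HasDerivAt ψ (ψ' r) r) (hψ'cont : ContinuousOn ψ' Ω)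
    (hψ0 : Filter.Tendsto (fun x : Ω => ψ x) Filter.atBot (nhds 0))
    (hψtop : Filter.Tendsto (fun x : Ω => ψ x) Filter.atTop Filter.atTop)
    (k : ℕ) (hk : 1 ≤ k) (hψk : ContDiffOn ℝ (k : ℕ∞) ψ Ω)
    (t : ℝ) (ht : t ∈ Set.Icc (a + h) b) :
    ContDiffOn ℝ ((k - 1 : ℕ) : ℕ∞) (fun r => muPsi a α h ψ ψ' f t r) Ω := by
  obtain ⟨n, rfl⟩ := Nat.exists_eq_add_of_le' hk
  have hψn : ContDiffOn ℝ n ψ Ω := hψk.of_le (by simp)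
  have hψ'n : ContDiffOn ℝ n ψ' Ω := by
    have h1 : ContDiffOn ℝ ((n : WithTop ℕ∞) + 1) ψ Ω := by simpa using hψk
    exact ((contDiffOn_succ_iff_deriv_of_isOpen hΩopen).1 h1).2.2.congr
      fun r hr => (hψderiv r hr).deriv.symm
  have hfI : ContinuousOn f (Set.uIcc a (t - h)) := by
    refine hf.mono ?_
    rw [Set.uIcc_of_le (by linarith [ht.1])]
    exact Set.Icc_subset_Icc_right (by linarith [ht.2])
  have hI := (contDiff_intervalIntegral_exp_mul n a (t - h) t f hfI).comp_contDiffOn hψn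
  exact ((contDiffOn_const.mul hψ'n).mul
    (hψn.rpow_const_of_ne fun r hr => (hψpos r hr).ne')).mul hI
end

section
/- Let a < b be real numbers, f : [a,b] → ℝ continuous, 0 < α < 1, c_α = sin(πα)/π, and 0 < h < b - a. Let Ω be a nonempty open interval and ψ : Ω → (0,∞) a strictly increasing admissible transformation. Then for every fixed t ∈ [a+h, b] there exists a constant C₁ > 0 such that for all r ∈ Ω, |μ(t,h,r)| ≤ C₁ ψ'(r) (ψ(r))^{-α-1} e^{-h ψ(r)}, where μ(t,h,r) = c_α ψ'(r) (ψ(r))^{-α} ∫_a^{t-h} e^{-(t-τ) ψ(r)} f(τ) dτ. In particular one may take C₁ = c_α · sup_{τ∈[a,b]} |f(τ)| (when f is not identically zero). -/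
open MeasureTheory

/-- The integral of `τ ↦ e^{-(t-τ)s} f(τ)` over `[a, t-h]` is at most `M e^{-hs}/s` in absolute
value when `|f| ≤ M` there. -/
theorem abs_integral_exp_mul_le {a h t s M : ℝ} {f : ℝ → ℝ} (hat : a ≤ t - h) (hs : 0 < s)
    (hM : 0 ≤ M) (hf : ∀ τ ∈ Set.Icc a (t - h), |f τ| ≤ M) :
    |∫ τ in a..(t - h), Real.exp (-(t - τ) * s) * f τ| ≤ M * (s⁻¹ * Real.exp (-h * s)) := by
  have hcont : Continuous fun τ : ℝ => Real.exp (-(t - τ) * s) * M := by fun_prop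
  have hbound : |∫ τ in a..(t - h), Real.exp (-(t - τ) * s) * f τ| ≤
      ∫ τ in a..(t - h), Real.exp (-(t - τ) * s) * M := by
    rw [← Real.norm_eq_abs]
    refine intervalIntegral.norm_integral_le_of_norm_le hat (Filter.Eventually.of_forall ?_)
      (hcont.intervalIntegrable _ _)
    intro τ hτ
    rw [norm_mul, Real.norm_of_nonneg (Real.exp_pos _).le, Real.norm_eq_abs]
    exact mul_le_mul_of_nonneg_left (hf τ ⟨hτ.1.le, hτ.2⟩) (Real.exp_pos _).le
  have hderiv : ∀ τ ∈ Set.uIcc a (t - h),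
      HasDerivAt (fun τ => Real.exp (-(t - τ) * s) * (s⁻¹ * M))
        (Real.exp (-(t - τ) * s) * M) τ := by
    intro τ _
    have hlin : HasDerivAt (fun τ : ℝ => -(t - τ) * s) s τ := by
      simpa using (((hasDerivAt_id τ).const_sub t).neg).mul_const s
    refine (hlin.exp.mul_const (s⁻¹ * M)).congr_deriv ?_
    field_simp
  rw [intervalIntegral.integral_eq_sub_of_hasDerivAt hderiv (hcont.intervalIntegrable _ _),
    show -(t - (t - h)) * s = -h * s by ring] at hbound
  have hnonneg : 0 ≤ Real.exp (-(t - a) * s) * (s⁻¹ * M) := by positivity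
  linarith

/-- Bound for `muPsi` at a point where `ψ` is positive and `ψ'` is nonnegative, for any bound `M`
of `|f|`. -/
theorem abs_muPsi_le {a α h t r M : ℝ} {f ψ ψ' : ℝ → ℝ} (hα0 : 0 < α) (hα1 : α < 1)
    (hat : a ≤ t - h) (hψ : 0 < ψ r) (hψ' : 0 ≤ ψ' r) (hM : 0 ≤ M)
    (hf : ∀ τ ∈ Set.Icc a (t - h), |f τ| ≤ M) :
    |muPsi a α h ψ ψ' f t r| ≤ (Real.sin (Real.pi * α) / Real.pi) * M *
      ψ' r * (ψ r) ^ (-α - 1) * Real.exp (-h * ψ r) := by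
  have hc : 0 ≤ Real.sin (Real.pi * α) / Real.pi :=
    div_nonneg (Real.sin_nonneg_of_nonneg_of_le_pi (by positivity)
      (mul_le_of_le_one_right Real.pi_pos.le hα1.le)) Real.pi_pos.le
  have hcoef : 0 ≤ Real.sin (Real.pi * α) / Real.pi * ψ' r * (ψ r) ^ (-α) :=
    mul_nonneg (mul_nonneg hc hψ') (Real.rpow_nonneg hψ.le _)
  rw [muPsi, abs_mul, abs_of_nonneg hcoef]
  refine (mul_le_mul_of_nonneg_left (abs_integral_exp_mul_le hat hψ hM hf) hcoef).trans_eq ?_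
  rw [Real.rpow_sub_one hψ.ne']
  ring

/-- For every fixed `t ∈ [a+h, b]` there is `C₁ > 0` with
`|μ(t,h,r)| ≤ C₁ ψ'(r) ψ(r)^{-α-1} e^{-hψ(r)}` for all `r ∈ Ω`; in particular the bound
holds with `C₁ = c_α · sup_{τ∈[a,b]} |f(τ)|`. -/
theorem muPsi_bound_at_sup (a b α h : ℝ) (hab : a < b) (f : ℝ → ℝ)
    (hf : ContinuousOn f (Set.Icc a b)) (hα0 : 0 < α) (hα1 : α < 1)
    (hh0 : 0 < h) (hhb : h < b - a)
    (Ω : Set ℝ) (hΩne : Ω.Nonempty) (hΩopen : IsOpen Ω) (hΩconn : Ω.OrdConnected)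
    (ψ ψ' : ℝ → ℝ) (hψpos : ∀ r ∈ Ω, 0 < ψ r) (hψmono : StrictMonoOn ψ Ω)
    (hψderiv : ∀ r ∈ Ω, HasDerivAt ψ (ψ' r) r) (hψ'cont : ContinuousOn ψ' Ω)
    (hψ0 : Filter.Tendsto (fun x : Ω => ψ x) Filter.atBot (nhds 0))
    (hψtop : Filter.Tendsto (fun x : Ω => ψ x) Filter.atTop Filter.atTop)
    (t : ℝ) (ht : t ∈ Set.Icc (a + h) b) :
    (∃ C₁ : ℝ, 0 < C₁ ∧ ∀ r ∈ Ω, |muPsi a α h ψ ψ' f t r|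
        ≤ C₁ * ψ' r * (ψ r) ^ (-α - 1) * Real.exp (-h * ψ r)) ∧
    (∀ r ∈ Ω, |muPsi a α h ψ ψ' f t r|
        ≤ (Real.sin (Real.pi * α) / Real.pi) * sSup ((fun τ => |f τ|) '' Set.Icc a b) *
            ψ' r * (ψ r) ^ (-α - 1) * Real.exp (-h * ψ r)) := by
  have hbdd : BddAbove ((fun τ => |f τ|) '' Set.Icc a b) :=
    (isCompact_Icc.image_of_continuousOn hf.abs).bddAbove
  have hf_le : ∀ τ ∈ Set.Icc a b, |f τ| ≤ sSup ((fun τ => |f τ|) '' Set.Icc a b) :=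
    fun τ hτ => le_csSup hbdd (Set.mem_image_of_mem _ hτ)
  have hM : 0 ≤ sSup ((fun τ => |f τ|) '' Set.Icc a b) :=
    (abs_nonneg (f a)).trans (hf_le a (Set.left_mem_Icc.2 hab.le))
  have hat : a ≤ t - h := by linarith [ht.1]
  have hsub : Set.Icc a (t - h) ⊆ Set.Icc a b := Set.Icc_subset_Icc_right (by linarith [ht.2])
  have hψ'nonneg : ∀ r ∈ Ω, 0 ≤ ψ' r := by
    intro r hr
    have hderivWithin := hψmono.monotoneOn.derivWithin_nonneg (x := r)
    rwa [derivWithin_of_isOpen hΩopen hr, (hψderiv r hr).deriv] at hderivWithin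
  have hsin : 0 < Real.sin (Real.pi * α) :=
    Real.sin_pos_of_pos_of_lt_pi (by positivity) (mul_lt_of_lt_one_right Real.pi_pos hα1)
  refine ⟨⟨Real.sin (Real.pi * α) / Real.pi * (sSup ((fun τ => |f τ|) '' Set.Icc a b) + 1),
    by positivity, fun r hr => ?_⟩, fun r hr => ?_⟩
  · exact abs_muPsi_le hα0 hα1 hat (hψpos r hr) (hψ'nonneg r hr) (by linarith)
      fun τ hτ => (hf_le τ (hsub hτ)).trans (by linarith)
  · exact abs_muPsi_le hα0 hα1 hat (hψpos r hr) (hψ'nonneg r hr) hM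
      fun τ hτ => hf_le τ (hsub hτ)
end

section
/- Let 0 < α < 1, h > 0, t > 0, and N ∈ ℤ with t e^{N h} ≥ 1 - α. Then the series ∑_{n=N+1}^{∞} h e^{(1-α) n h} e^{-t e^{n h}} converges and ∑_{n=N+1}^{∞} h e^{(1-α) n h} e^{-t e^{n h}} ≤ t^{α-1} ∫_{t e^{N h}}^{∞} s^{-α} e^{-s} ds. -/
open MeasureTheory

/-- The function `y ↦ a y - t e^y` is antitone on the half-line where its derivative is
nonpositive. -/
lemma antitoneOn_mul_sub_mul_exp {a t y₀ : ℝ} (ht : 0 ≤ t) (hy₀ : a ≤ t * Real.exp y₀) :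
    AntitoneOn (fun y : ℝ => a * y - t * Real.exp y) (Set.Ici y₀) := by
  intro x hx y _ hxy
  have hax : a ≤ t * Real.exp x :=
    hy₀.trans (mul_le_mul_of_nonneg_left (Real.exp_le_exp.2 hx) ht)
  have hexp : Real.exp x * (y - x + 1) ≤ Real.exp y := by
    calc Real.exp x * (y - x + 1) ≤ Real.exp x * Real.exp (y - x) :=
          mul_le_mul_of_nonneg_left (Real.add_one_le_exp _) (Real.exp_pos x).le
      _ = Real.exp y := by rw [← Real.exp_add, add_sub_cancel]
  have h₁ := mul_le_mul_of_nonneg_left hexp ht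
  have h₂ := mul_le_mul_of_nonneg_right hax (sub_nonneg.2 hxy)
  simp only
  linarith

/-- The function `x ↦ h e^{(1-α)xh} e^{-t e^{xh}}` is the pullback of
`t^{α-1} s^{-α} e^{-s} ds` under `s = t e^{xh}`. -/
lemma mul_exp_mul_exp_eq_rpow_mul {t : ℝ} (ht : 0 < t) (α h x : ℝ) :
    h * Real.exp ((1 - α) * (x * h)) * Real.exp (-t * Real.exp (x * h)) =
      t ^ (α - 1) * (((t * Real.exp (x * h)) ^ (-α) * Real.exp (-(t * Real.exp (x * h)))) *
        (t * (Real.exp (x * h) * h))) := by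
  have h₁ : t ^ (α - 1) * t ^ (-α) * t = 1 := by
    rw [← Real.rpow_add ht, ← Real.rpow_add_one ht.ne', show α - 1 + -α + 1 = 0 by ring, Real.rpow_zero]
  have h₂ : Real.exp ((1 - α) * (x * h)) = Real.exp (x * h * -α) * Real.exp (x * h) := by
    rw [← Real.exp_add]
    ring_nf
  rw [Real.mul_rpow ht.le (Real.exp_pos _).le, ← Real.exp_mul, h₂, neg_mul]
  linear_combination (-(h * Real.exp (x * h * -α) * Real.exp (x * h) *
    Real.exp (-(t * Real.exp (x * h))))) * h₁

/-- Integrals of `x ↦ h e^{(1-α)xh} e^{-t e^{xh}}` are bounded by an upper incomplete Gamma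
function. -/
lemma integral_mul_exp_mul_exp_le {α h t a b : ℝ} (hα : α < 1) (hh : 0 ≤ h) (ht : 0 < t)
    (hab : a ≤ b) :
    ∫ x in a..b, h * Real.exp ((1 - α) * (x * h)) * Real.exp (-t * Real.exp (x * h)) ≤
      t ^ (α - 1) * ∫ s in Set.Ioi (t * Real.exp (a * h)), s ^ (-α) * Real.exp (-s) := by
  have hderiv : ∀ x : ℝ,
      HasDerivAt (fun x => t * Real.exp (x * h)) (t * (Real.exp (x * h) * h)) x := fun x => by
    simpa using (((hasDerivAt_id x).mul_const h).exp).const_mul t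
  have hpos : ∀ x : ℝ, 0 < t * Real.exp (x * h) := fun x => by positivity
  have hle : t * Real.exp (a * h) ≤ t * Real.exp (b * h) := by gcongr
  have hint : IntegrableOn (fun s : ℝ => s ^ (-α) * Real.exp (-s))
      (Set.Ioi (t * Real.exp (a * h))) := by
    have := (Real.GammaIntegral_convergent (sub_pos.2 hα)).mono_set
      (Set.Ioi_subset_Ioi (hpos a).le)
    refine this.congr_fun (fun s _ => ?_) measurableSet_Ioi
    simp only
    rw [mul_comm, show 1 - α - 1 = -α by ring]
  simp_rw [mul_exp_mul_exp_eq_rpow_mul ht]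
  rw [intervalIntegral.integral_const_mul]
  refine mul_le_mul_of_nonneg_left ?_ (Real.rpow_nonneg ht.le _)
  have hsub := intervalIntegral.integral_comp_mul_deriv' (a := a) (b := b)
    (g := fun s : ℝ => s ^ (-α) * Real.exp (-s)) (fun x _ => hderiv x)
    (by fun_prop) (by
      rintro _ ⟨x, _, rfl⟩
      exact ((Real.continuousAt_rpow_const _ _ (Or.inl (hpos x).ne')).mul
        (by fun_prop)).continuousWithinAt)
  refine hsub.trans_le ?_
  rw [intervalIntegral.integral_of_le hle]
  refine setIntegral_mono_set hint ?_ Set.Ioc_subset_Ioi_self.eventuallyLE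
  filter_upwards [ae_restrict_mem measurableSet_Ioi] with s hs
  have : 0 < s := (hpos a).trans hs
  simp only [Pi.zero_apply]
  positivity

/-- Upper truncation error of the trapezoidal exponential-sum approximation:
if `t e^{Nh} ≥ 1-α`, then `∑_{n=N+1}^{∞} h e^{(1-α)nh} e^{-t e^{nh}}` converges and is
bounded by `t^{α-1} Γ(1-α, t e^{Nh})`, with the upper incomplete Gamma function written
as an explicit integral. The series is indexed by `n = N+1+j`, `j ∈ ℕ`. -/
theorem trapezoidal_upper_truncation_error (α h t : ℝ) (N : ℤ)
    (hα0 : 0 < α) (hα1 : α < 1) (hh : 0 < h) (ht : 0 < t)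
    (hN : 1 - α ≤ t * Real.exp ((N : ℝ) * h)) :
    Summable (fun j : ℕ =>
      h * Real.exp ((1 - α) * (((N : ℝ) + 1 + j) * h)) *
        Real.exp (-t * Real.exp (((N : ℝ) + 1 + j) * h))) ∧
    (∑' j : ℕ, h * Real.exp ((1 - α) * (((N : ℝ) + 1 + j) * h)) *
        Real.exp (-t * Real.exp (((N : ℝ) + 1 + j) * h)))
      ≤ t ^ (α - 1) *
          ∫ s in Set.Ioi (t * Real.exp ((N : ℝ) * h)), s ^ (-α) * Real.exp (-s) := by
  have hanti : ∀ n : ℕ, AntitoneOn (fun x : ℝ =>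
      h * Real.exp ((1 - α) * (x * h)) * Real.exp (-t * Real.exp (x * h)))
      (Set.Icc (N : ℝ) (N + n)) := by
    intro n x hx y hy hxy
    have hle := antitoneOn_mul_sub_mul_exp ht.le hN
      (Set.mem_Ici.2 (mul_le_mul_of_nonneg_right hx.1 hh.le))
      (Set.mem_Ici.2 (mul_le_mul_of_nonneg_right hy.1 hh.le))
      (mul_le_mul_of_nonneg_right hxy hh.le)
    simp only [mul_assoc, ← Real.exp_add]
    refine mul_le_mul_of_nonneg_left (Real.exp_le_exp.2 ?_) hh.le
    simp only at hle
    linarith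
  have hnonneg : ∀ j : ℕ, 0 ≤ h * Real.exp ((1 - α) * (((N : ℝ) + 1 + j) * h)) *
      Real.exp (-t * Real.exp (((N : ℝ) + 1 + j) * h)) := fun j => by positivity
  have hsum : ∀ n : ℕ, ∑ j ∈ Finset.range n,
      h * Real.exp ((1 - α) * (((N : ℝ) + 1 + j) * h)) *
        Real.exp (-t * Real.exp (((N : ℝ) + 1 + j) * h)) ≤
      t ^ (α - 1) *
        ∫ s in Set.Ioi (t * Real.exp ((N : ℝ) * h)), s ^ (-α) * Real.exp (-s) := by
    intro n
    refine le_trans (le_of_eq ?_) ((hanti n).sum_le_integral.trans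
      (integral_mul_exp_mul_exp_le hα1 hh.le ht (by simp)))
    refine Finset.sum_congr rfl fun j _ => ?_
    rw [show (N : ℝ) + 1 + j = N + ((j + 1 : ℕ) : ℝ) by push_cast; ring]
  exact ⟨summable_of_sum_range_le hnonneg hsum, Real.tsum_le_of_sum_range_le hnonneg hsum⟩
end

section
/- Let 0 < α < 1, h > 0, t > 0, and M ∈ ℤ with t e^{-M h} ≤ 1 - α. Then the series ∑_{n=-∞}^{-M-1} h e^{(1-α) n h} e^{-t e^{n h}} converges and ∑_{n=-∞}^{-M-1} h e^{(1-α) n h} e^{-t e^{n h}} ≤ t^{α-1} ∫_0^{t e^{-M h}} s^{-α} e^{-s} ds. -/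
open MeasureTheory

/-- The function `x ↦ x ^ a * exp (-x)` is nondecreasing on `(0, a]`. -/
theorem monotoneOn_rpow_mul_exp_neg (a : ℝ) :
    MonotoneOn (fun x : ℝ => x ^ a * Real.exp (-x)) (Set.Ioc 0 a) := by
  rintro x ⟨hx, -⟩ y ⟨hy, hya⟩ hxy
  have hlog : Real.log x - Real.log y ≤ x / y - 1 := by
    rw [← Real.log_div hx.ne' hy.ne']
    exact Real.log_le_sub_one_of_pos (div_pos hx hy)
  have hdiv : y - x ≤ a * (1 - x / y) := by
    have hnonneg : 0 ≤ 1 - x / y := sub_nonneg.2 ((div_le_one hy).2 hxy)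
    calc y - x = y * (1 - x / y) := by field_simp
      _ ≤ a * (1 - x / y) := mul_le_mul_of_nonneg_right hya hnonneg
  have ha : 0 < a := hy.trans_le hya
  simp only [Real.rpow_def_of_pos hx, Real.rpow_def_of_pos hy, ← Real.exp_add]
  refine Real.exp_le_exp.2 ?_
  nlinarith [mul_le_mul_of_nonneg_left hlog ha.le]

theorem integrableOn_rpow_neg_mul_exp_neg {α : ℝ} (hα : α < 1) :
    IntegrableOn (fun s : ℝ => s ^ (-α) * Real.exp (-s)) (Set.Ioi 0) := by
  refine (Real.GammaIntegral_convergent (sub_pos.2 hα)).congr_fun (fun s _ => ?_)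
    measurableSet_Ioi
  simp only [sub_sub_cancel_left, mul_comm]

theorem intervalIntegrable_rpow_neg_mul_exp_neg {α x y : ℝ} (hα : α < 1)
    (hx : 0 ≤ x) (hy : 0 ≤ y) :
    IntervalIntegrable (fun s : ℝ => s ^ (-α) * Real.exp (-s)) volume x y := by
  refine intervalIntegrable_iff.2 ((integrableOn_rpow_neg_mul_exp_neg hα).mono_set ?_)
  exact fun s hs => (le_min hx hy).trans_lt hs.1

/-- A left Riemann sum cell, in logarithmic scale, of the lower incomplete Gamma integral. -/
theorem log_step_mul_le_integral {α h x : ℝ} (hα : α < 1) (hh : 0 ≤ h) (hx : 0 < x)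
    (hxα : x * Real.exp h ≤ 1 - α) :
    h * (x ^ (1 - α) * Real.exp (-x)) ≤
      ∫ s in x..(x * Real.exp h), s ^ (-α) * Real.exp (-s) := by
  have hxy : x ≤ x * Real.exp h := le_mul_of_one_le_right hx.le (Real.one_le_exp hh)
  have hy : 0 < x * Real.exp h := hx.trans_le hxy
  have hzero : (0 : ℝ) ∉ Set.uIcc x (x * Real.exp h) := Set.notMem_uIcc_of_lt hx hy
  have hint : h * (x ^ (1 - α) * Real.exp (-x)) =
      ∫ s in x..(x * Real.exp h), s⁻¹ * (x ^ (1 - α) * Real.exp (-x)) := by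
    rw [intervalIntegral.integral_mul_const, integral_inv hzero,
      mul_div_cancel_left₀ _ hx.ne', Real.log_exp]
  rw [hint]
  refine intervalIntegral.integral_mono_on hxy
    ((intervalIntegral.intervalIntegrable_inv (fun s hs => ne_of_mem_of_not_mem hs hzero)
      continuousOn_id).mul_const _)
    (intervalIntegrable_rpow_neg_mul_exp_neg hα hx.le hy.le) fun s hs => ?_
  have hs0 : 0 < s := hx.trans_le hs.1
  have hmono := monotoneOn_rpow_mul_exp_neg (1 - α) ⟨hx, hxy.trans hxα⟩
    ⟨hs0, hs.2.trans hxα⟩ hs.1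
  calc s⁻¹ * (x ^ (1 - α) * Real.exp (-x)) ≤ s⁻¹ * (s ^ (1 - α) * Real.exp (-s)) :=
        mul_le_mul_of_nonneg_left hmono (inv_nonneg.2 hs0.le)
    _ = s ^ (-α) * Real.exp (-s) := by
        rw [sub_eq_add_neg, Real.rpow_add hs0, Real.rpow_one]
        field_simp

/-- Lower truncation error of the trapezoidal exponential-sum approximation:
if `t e^{-Mh} ≤ 1-α`, then `∑_{n=-∞}^{-M-1} h e^{(1-α)nh} e^{-t e^{nh}}` converges and is
bounded by `t^{α-1} (Γ(1-α) - Γ(1-α, t e^{-Mh}))`, with the lower incomplete Gamma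
function written as an explicit integral. The series is indexed by `n = -M-1-j`, `j ∈ ℕ`. -/
theorem trapezoidal_lower_truncation_error (α h t : ℝ) (M : ℤ)
    (hα0 : 0 < α) (hα1 : α < 1) (hh : 0 < h) (ht : 0 < t)
    (hM : t * Real.exp (-(M : ℝ) * h) ≤ 1 - α) :
    Summable (fun j : ℕ =>
      h * Real.exp ((1 - α) * ((-(M : ℝ) - 1 - j) * h)) *
        Real.exp (-t * Real.exp ((-(M : ℝ) - 1 - j) * h))) ∧
    (∑' j : ℕ, h * Real.exp ((1 - α) * ((-(M : ℝ) - 1 - j) * h)) *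
        Real.exp (-t * Real.exp ((-(M : ℝ) - 1 - j) * h)))
      ≤ t ^ (α - 1) *
          ∫ s in Set.Ioo (0 : ℝ) (t * Real.exp (-(M : ℝ) * h)),
            s ^ (-α) * Real.exp (-s) := by
  set F : ℝ → ℝ := fun x => ∫ s in (0 : ℝ)..x, s ^ (-α) * Real.exp (-s) with hF
  set x : ℕ → ℝ := fun j => t * Real.exp ((-(M : ℝ) - j) * h) with hx
  have hx_pos (j : ℕ) : 0 < x j := mul_pos ht (Real.exp_pos _)
  have hx_zero : x 0 = t * Real.exp (-(M : ℝ) * h) := by simp [hx]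
  have hx_le (j : ℕ) : x j ≤ 1 - α := by
    refine le_trans ?_ hM
    simp only [hx]
    gcongr
    linarith [(Nat.cast_nonneg j : (0 : ℝ) ≤ j)]
  have hx_succ (j : ℕ) : x (j + 1) * Real.exp h = x j := by
    simp only [hx, mul_assoc, ← Real.exp_add]
    push_cast
    ring_nf
  set u : ℕ → ℝ := fun j => h * Real.exp ((1 - α) * ((-(M : ℝ) - 1 - j) * h)) *
    Real.exp (-t * Real.exp ((-(M : ℝ) - 1 - j) * h)) with hu
  have hu_nonneg (j : ℕ) : 0 ≤ u j := by positivity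
  have hu_eq (j : ℕ) :
      u j = t ^ (α - 1) * (h * (x (j + 1) ^ (1 - α) * Real.exp (-x (j + 1)))) := by
    have hcancel : t ^ (α - 1) * t ^ (1 - α) = 1 := by
      rw [← Real.rpow_add ht]
      simp
    have hexponent : -(M : ℝ) - ((j + 1 : ℕ) : ℝ) = -(M : ℝ) - 1 - j := by
      push_cast
      ring
    simp only [hu, hx, hexponent]
    rw [Real.mul_rpow ht.le (Real.exp_pos _).le, ← Real.exp_mul, neg_mul,
      mul_comm (1 - α)]
    linear_combination (-(h * Real.exp ((-(M : ℝ) - 1 - j) * h * (1 - α)) *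
      Real.exp (-(t * Real.exp ((-(M : ℝ) - 1 - j) * h))))) * hcancel
  have hu_le (j : ℕ) : u j ≤ t ^ (α - 1) * F (x j) - t ^ (α - 1) * F (x (j + 1)) := by
    have hstep := log_step_mul_le_integral hα1 hh.le (hx_pos (j + 1))
      ((hx_succ j).trans_le (hx_le j))
    rw [hx_succ, ← intervalIntegral.integral_interval_sub_left
      (intervalIntegrable_rpow_neg_mul_exp_neg hα1 le_rfl (hx_pos j).le)
      (intervalIntegrable_rpow_neg_mul_exp_neg hα1 le_rfl (hx_pos (j + 1)).le)] at hstep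
    rw [hu_eq, ← mul_sub]
    exact mul_le_mul_of_nonneg_left hstep (Real.rpow_nonneg ht.le _)
  have hF_nonneg (j : ℕ) : 0 ≤ t ^ (α - 1) * F (x j) := by
    refine mul_nonneg (Real.rpow_nonneg ht.le _)
      (intervalIntegral.integral_nonneg (hx_pos j).le fun s hs => ?_)
    exact mul_nonneg (Real.rpow_nonneg hs.1 _) (Real.exp_pos _).le
  have hsum (n : ℕ) : ∑ j ∈ Finset.range n, u j ≤ t ^ (α - 1) * F (x 0) := by
    calc ∑ j ∈ Finset.range n, u j
        ≤ ∑ j ∈ Finset.range n, (t ^ (α - 1) * F (x j) - t ^ (α - 1) * F (x (j + 1))) :=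
          Finset.sum_le_sum fun j _ => hu_le j
      _ = t ^ (α - 1) * F (x 0) - t ^ (α - 1) * F (x n) :=
          Finset.sum_range_sub' (fun j => t ^ (α - 1) * F (x j)) n
      _ ≤ t ^ (α - 1) * F (x 0) := sub_le_self _ (hF_nonneg n)
  refine ⟨summable_of_sum_range_le hu_nonneg hsum, ?_⟩
  rw [← hx_zero, ← integral_Ioc_eq_integral_Ioo,
    ← intervalIntegral.integral_of_le (hx_pos 0).le]
  exact Real.tsum_le_of_sum_range_le hu_nonneg hsum
end
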